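/- arXiv:2503.22999 — 3 statements merged into one kernel-verified Lean document; each statement's English description precedes it below -/
import Mathlib

section
/- Let T be a doubly stochastic N×N matrix and p a probability distribution on a set of N elements, and let p' = Tp, i.e., p'_i = Σ_j T_{ij} p_j. Then p' is again a probability distribution and H(p') ≥ H(p): the application of a doubly stochastic matrix does not decrease the Shannon entropy. -/
/-- Shannon entropy of a probability distribution on a finite set,
with the natural logarithm and the convention `0 * log 0 = 0`. -/
noncomputable def shannonEntropy {S : Type*} [Fintype S] (p : S → ℝ) : ℝ :=
  -∑ i, p i * Real.log (p i)

/-- A doubly stochastic matrix does not increase the sum of the values of a convex function. -/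
theorem ConvexOn.sum_mulVec_le {n : Type*} [Fintype n] {s : Set ℝ} {f : ℝ → ℝ}
    (hf : ConvexOn ℝ s f) {T : Matrix n n ℝ} (hT0 : ∀ i j, 0 ≤ T i j)
    (hTcol : ∀ j, ∑ i, T i j = 1) (hTrow : ∀ i, ∑ j, T i j = 1)
    {p : n → ℝ} (hp : ∀ i, p i ∈ s) :
    ∑ i, f (T.mulVec p i) ≤ ∑ i, f (p i) :=
  calc ∑ i, f (T.mulVec p i) ≤ ∑ i, ∑ j, T i j * f (p j) :=
        Finset.sum_le_sum fun i _ =>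
          hf.map_sum_le (fun j _ => hT0 i j) (hTrow i) (fun j _ => hp j)
    _ = ∑ j, f (p j) := by
        rw [Finset.sum_comm]
        simp_rw [← Finset.sum_mul, hTcol, one_mul]

/-- If `T` is a doubly stochastic `N×N` matrix (nonnegative entries, all
column sums and all row sums equal to `1`) and `p` a probability distribution, then
`p' = Tp` (i.e. `p'_i = ∑_j T_{ij} p_j`) is again a probability distribution and
`H(p') ≥ H(p)`. -/
theorem doublyStochastic_entropy_nondecreasing {N : ℕ}
    (T : Matrix (Fin N) (Fin N) ℝ)
    (hT0 : ∀ i j, 0 ≤ T i j)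
    (hTcol : ∀ j, ∑ i, T i j = 1)
    (hTrow : ∀ i, ∑ j, T i j = 1)
    (p : Fin N → ℝ) (hp0 : ∀ i, 0 ≤ p i) (hp1 : ∑ i, p i = 1) :
    (∀ i, 0 ≤ T.mulVec p i) ∧ (∑ i, T.mulVec p i = 1) ∧
      shannonEntropy p ≤ shannonEntropy (T.mulVec p) := by
  refine ⟨fun i => dotProduct_nonneg_of_nonneg (hT0 i) hp0, ?_,
    neg_le_neg (Real.convexOn_mul_log.sum_mulVec_le hT0 hTcol hTrow hp0)⟩
  simp_rw [Matrix.mulVec, dotProduct]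
  rw [Finset.sum_comm]
  simp_rw [← Finset.sum_mul, hTcol, one_mul, hp1]
end

section
/- Let N ≥ 2 and let T be a stochastic N×N matrix. Define the square matrix R, indexed by pairs (m,i) with m, i ∈ {1,…,N} (identifying the apparatus set A with {1,…,N} and fixing the index 1 as the default apparatus state), by R_{(m,i),(n,j)} = T_{mi} δ_{in} if j = 1, and R_{(m,i),(n,j)} = (1 - T_{mi})/(N(N-1)) if j ≠ 1. Then R is doubly stochastic, and with the pure apparatus distribution ρ_j = δ_{j1} it satisfies Σ_{i,j} R_{(m,i),(n,j)} ρ_j = T_{mn} for all m, n; hence every stochastic matrix T admits a model (A, ρ, R) with A = {1,…,N}, ρ pure, and R doubly stochastic, satisfying M₁(R(p ⊗ ρ)) = Tp for all probability distributions p. -/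
theorem sum_ite_eq_const_else {N : ℕ} (d : Fin N) (a b : ℝ) :
    ∑ j : Fin N, (if j = d then a else b) = a + ((N : ℝ) - 1) * b := by
  have h : ∀ j : Fin N, (if j = d then a else b) = (if j = d then a - b else 0) + b := by
    intro j
    split_ifs <;> ring
  simp only [h, Finset.sum_add_distrib, Finset.sum_ite_eq', Finset.mem_univ, if_true,
    Finset.sum_const, Finset.card_univ, Fintype.card_fin, nsmul_eq_mul]
  ring


/-- For `N ≥ 2` and a stochastic `N×N` matrix `T`, the matrix `R` on
pairs `(m,i)` (apparatus set `A = {1,…,N}`, default apparatus state `d` the first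
index) defined by `R_{(m,i),(n,j)} = T_{mi} δ_{in}` if `j = d` and
`R_{(m,i),(n,j)} = (1 - T_{mi})/(N(N-1))` otherwise, is doubly stochastic and, with
the pure apparatus distribution `ρ_j = δ_{jd}`, satisfies
`∑_{i,j} R_{(m,i),(n,j)} ρ_j = T_{mn}`; hence `(A, ρ, R)` is a model of `T`:
`M₁(R(p ⊗ ρ)) = Tp` for all probability distributions `p`. -/
theorem explicit_model_of_stochastic_matrix {N : ℕ} (hN : 2 ≤ N)
    (T : Matrix (Fin N) (Fin N) ℝ)
    (hT0 : ∀ i j, 0 ≤ T i j)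
    (hTcol : ∀ j, ∑ i, T i j = 1)
    (d : Fin N) (hd : (d : ℕ) = 0)
    (R : Matrix (Fin N × Fin N) (Fin N × Fin N) ℝ)
    (hR : ∀ m i n j, R (m, i) (n, j) =
      if j = d then T m i * (if i = n then 1 else 0)
      else (1 - T m i) / ((N : ℝ) * ((N : ℝ) - 1)))
    (ρ : Fin N → ℝ) (hρ : ∀ j, ρ j = if j = d then 1 else 0) :
    (∀ x y, 0 ≤ R x y) ∧ (∀ y, ∑ x, R x y = 1) ∧ (∀ x, ∑ y, R x y = 1) ∧
    (∀ m n, ∑ i, ∑ j, R (m, i) (n, j) * ρ j = T m n) ∧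
    (∀ p : Fin N → ℝ, (∀ n, 0 ≤ p n) → (∑ n, p n = 1) →
      ∀ m, ∑ i, R.mulVec (fun x => p x.1 * ρ x.2) (m, i) = T.mulVec p m) := by
  have hN' : (2 : ℝ) ≤ N := by exact_mod_cast hN
  have hN0 : (N : ℝ) ≠ 0 := by linarith
  have hN1 : (N : ℝ) - 1 ≠ 0 := by linarith
  have hT1 : ∀ i j, T i j ≤ 1 := fun i j => by
    rw [← hTcol j]
    exact Finset.single_le_sum (f := fun i => T i j) (fun k _ => hT0 k j) (Finset.mem_univ i)
  have hmarg : ∀ m n, ∑ i, ∑ j, R (m, i) (n, j) * ρ j = T m n := by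
    intro m n
    simp [hR, hρ]
  refine ⟨?_, ?_, ?_, hmarg, ?_⟩
  · rintro ⟨m, i⟩ ⟨n, j⟩
    rw [hR]
    split_ifs
    · simpa using hT0 m i
    · simp
    · exact div_nonneg (sub_nonneg.2 (hT1 m i)) (mul_nonneg (by linarith) (by linarith))
  · rintro ⟨n, j⟩
    rw [Fintype.sum_prod_type]
    simp only [hR]
    split_ifs with h
    · simpa using hTcol n
    · rw [Finset.sum_comm]
      simp only [← Finset.sum_div, Finset.sum_sub_distrib, hTcol, Finset.sum_const,
        Finset.card_univ, Fintype.card_fin, nsmul_eq_mul]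
      field_simp
  · rintro ⟨m, i⟩
    rw [Fintype.sum_prod_type]
    simp only [hR, sum_ite_eq_const_else, Finset.sum_add_distrib, Finset.sum_const,
      Finset.card_univ, Fintype.card_fin, nsmul_eq_mul, ← Finset.mul_sum, Finset.sum_ite_eq,
      Finset.mem_univ, if_true]
    field_simp
    ring
  · intro p _ _ m
    simp only [Matrix.mulVec, dotProduct, Fintype.sum_prod_type]
    rw [Finset.sum_comm]
    refine Finset.sum_congr rfl fun n _ => ?_
    rw [← hmarg m n, Finset.sum_mul]
    refine Finset.sum_congr rfl fun i _ => ?_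
    rw [Finset.sum_mul]
    exact Finset.sum_congr rfl fun j _ => by ring
end

section
/- Let T be a stochastic N×N matrix and (A, ρ, R) a model of T, i.e., A a finite set, ρ a probability distribution on A, R a doubly stochastic matrix indexed by {1,…,N} × A with M₁(R(p ⊗ ρ)) = Tp for all probability distributions p. Then for every probability distribution p, writing P_fin = R(p ⊗ ρ), one has H(p) - H(Tp) ≤ H(M₂ P_fin) - H(ρ) - I(P_fin): the decrease of entropy of the system is at most the increase of entropy of the apparatus minus the final mutual information (modified Szilard principle). -/
/-- First marginal `(M₁P)(i) = ∑_μ P(i,μ)`. -/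
noncomputable def marg1 {S A : Type*} [Fintype A] (P : S × A → ℝ) : S → ℝ :=
  fun i => ∑ μ, P (i, μ)

/-- Second marginal `(M₂P)(μ) = ∑_i P(i,μ)`. -/
noncomputable def marg2 {S A : Type*} [Fintype S] (P : S × A → ℝ) : A → ℝ :=
  fun μ => ∑ i, P (i, μ)

/-- Mutual information `I(P) = H(M₁P) + H(M₂P) - H(P)`. -/
noncomputable def mutualInfo {S A : Type*} [Fintype S] [Fintype A] (P : S × A → ℝ) : ℝ :=
  shannonEntropy (marg1 P) + shannonEntropy (marg2 P) - shannonEntropy P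

theorem shannonEntropy_eq_sum_negMulLog {S : Type*} [Fintype S] (p : S → ℝ) :
    shannonEntropy p = ∑ i, Real.negMulLog (p i) := by
  simp [shannonEntropy, Real.negMulLog, Finset.sum_neg_distrib]

/-- The entropy of a product distribution is the sum of the entropies. -/
theorem shannonEntropy_prod {S A : Type*} [Fintype S] [Fintype A] (p : S → ℝ) (q : A → ℝ)
    (hp : ∑ i, p i = 1) (hq : ∑ j, q j = 1) :
    shannonEntropy (fun x : S × A => p x.1 * q x.2) = shannonEntropy p + shannonEntropy q := by
  simp only [shannonEntropy_eq_sum_negMulLog, Real.negMulLog_mul, Fintype.sum_prod_type,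
    Finset.sum_add_distrib, ← Finset.sum_mul, ← Finset.mul_sum, hp, hq, one_mul]

/-- Doubly stochastic matrices do not decrease entropy. -/
theorem shannonEntropy_le_mulVec {S : Type*} [Fintype S] (R : Matrix S S ℝ)
    (hR0 : ∀ x y, 0 ≤ R x y) (hRcol : ∀ y, ∑ x, R x y = 1) (hRrow : ∀ x, ∑ y, R x y = 1)
    (q : S → ℝ) (hq : ∀ x, 0 ≤ q x) :
    shannonEntropy q ≤ shannonEntropy (R.mulVec q) := by
  simp only [shannonEntropy_eq_sum_negMulLog]
  calc ∑ y, Real.negMulLog (q y) = ∑ y, ∑ x, R x y * Real.negMulLog (q y) := by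
        simp only [← Finset.sum_mul, hRcol, one_mul]
    _ = ∑ x, ∑ y, R x y * Real.negMulLog (q y) := Finset.sum_comm
    _ ≤ ∑ x, Real.negMulLog (R.mulVec q x) := Finset.sum_le_sum fun x _ =>
        Real.concaveOn_negMulLog.le_map_sum (fun y _ => hR0 x y) (hRrow x) fun y _ => hq y

/-- modified Szilard principle: If `(A, ρ, R)` is a model of the
stochastic matrix `T` (i.e. `R` doubly stochastic with `M₁(R(p ⊗ ρ)) = Tp` for all
probability distributions `p`), then for every probability distribution `p`, with
`P_fin = R(p ⊗ ρ)`, one has `H(p) - H(Tp) ≤ H(M₂ P_fin) - H(ρ) - I(P_fin)`. -/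
theorem modified_szilard_principle {N : ℕ} {A : Type*} [Fintype A]
    (T : Matrix (Fin N) (Fin N) ℝ)
    (hT0 : ∀ i j, 0 ≤ T i j)
    (hTcol : ∀ j, ∑ i, T i j = 1)
    (ρ : A → ℝ) (hρ0 : ∀ j, 0 ≤ ρ j) (hρ1 : ∑ j, ρ j = 1)
    (R : Matrix (Fin N × A) (Fin N × A) ℝ)
    (hR0 : ∀ x y, 0 ≤ R x y)
    (hRcol : ∀ y, ∑ x, R x y = 1)
    (hRrow : ∀ x, ∑ y, R x y = 1)
    (hmodel : ∀ p : Fin N → ℝ, (∀ n, 0 ≤ p n) → (∑ n, p n = 1) →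
        ∀ m, ∑ i : A, R.mulVec (fun x => p x.1 * ρ x.2) (m, i) = T.mulVec p m)
    (p : Fin N → ℝ) (hp0 : ∀ n, 0 ≤ p n) (hp1 : ∑ n, p n = 1) :
    shannonEntropy p - shannonEntropy (T.mulVec p) ≤
      shannonEntropy (marg2 (R.mulVec (fun x => p x.1 * ρ x.2))) - shannonEntropy ρ
        - mutualInfo (R.mulVec (fun x => p x.1 * ρ x.2)) := by
  have hmarg : marg1 (R.mulVec (fun x => p x.1 * ρ x.2)) = T.mulVec p :=
    funext (hmodel p hp0 hp1)
  have hmono := shannonEntropy_le_mulVec R hR0 hRcol hRrow (fun x => p x.1 * ρ x.2)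
    fun x => mul_nonneg (hp0 x.1) (hρ0 x.2)
  rw [shannonEntropy_prod p ρ hp1 hρ1] at hmono
  rw [mutualInfo, hmarg]
  linarith
end
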